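/- Let M be any ℤ-module and n = 2. Then P₂(M) = S'₂(M): the submodule of T²(M) generated by the squares x⊗x (x ∈ M) equals the submodule of symmetric tensors. -/

import Mathlib

/-- The linear map on the `n`-th tensor power `Tⁿ(M)` permuting the factors by
`σ`: it sends `x₁ ⊗ ⋯ ⊗ xₙ` to `x_{σ⁻¹(1)} ⊗ ⋯ ⊗ x_{σ⁻¹(n)}`. -/
noncomputable def permMap (A M : Type*) [CommRing A] [AddCommGroup M] [Module A M]
    (n : ℕ) (σ : Equiv.Perm (Fin n)) :
    PiTensorProduct A (fun _ : Fin n => M) →ₗ[A] PiTensorProduct A (fun _ : Fin n => M) :=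
  (PiTensorProduct.reindex A (fun _ : Fin n => M) σ).toLinearMap

/-- `S'ₙ(M)`: the submodule of symmetric tensors in `Tⁿ(M)`. -/
noncomputable def symTensors (A M : Type*) [CommRing A] [AddCommGroup M] [Module A M]
    (n : ℕ) : Submodule A (PiTensorProduct A (fun _ : Fin n => M)) :=
  ⨅ σ : Equiv.Perm (Fin n), LinearMap.eqLocus (permMap A M n σ) LinearMap.id

/-- The symmetrization map `z ↦ ∑_{σ ∈ Sₙ} σ z` on `Tⁿ(M)`. -/
noncomputable def symmetrize (A M : Type*) [CommRing A] [AddCommGroup M] [Module A M]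
    (n : ℕ) :
    PiTensorProduct A (fun _ : Fin n => M) →ₗ[A] PiTensorProduct A (fun _ : Fin n => M) :=
  ∑ σ : Equiv.Perm (Fin n), permMap A M n σ

/-- `Pₙ(M)`: the submodule of `Tⁿ(M)` generated by the `n`-th tensor powers
`x ⊗ ⋯ ⊗ x` of elements `x ∈ M`. -/
noncomputable def powersSubmodule (A M : Type*) [CommRing A] [AddCommGroup M] [Module A M]
    (n : ℕ) : Submodule A (PiTensorProduct A (fun _ : Fin n => M)) :=
  Submodule.span A {z | ∃ x : M, z = PiTensorProduct.tprod A (fun _ : Fin n => x)}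

open TensorProduct

theorem Submodule.sum_sum_mem_of_add_swap_mem {R V ι : Type*} [Semiring R] [AddCommMonoid V]
    [Module R V] (S : Submodule R V) (F : ι → ι → V) (hdiag : ∀ i, F i i ∈ S)
    (hswap : ∀ i j, F i j + F j i ∈ S) (s : Finset ι) :
    ∑ i ∈ s, ∑ j ∈ s, F i j ∈ S := by
  classical
  induction s using Finset.induction_on with
  | empty => simp
  | insert a s ha ih =>
    have key : ∑ i ∈ insert a s, ∑ j ∈ insert a s, F i j =
        F a a + ∑ j ∈ s, (F a j + F j a) + ∑ i ∈ s, ∑ j ∈ s, F i j := by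
      simp only [Finset.sum_insert ha, Finset.sum_add_distrib, add_assoc]
    rw [key]
    exact S.add_mem (S.add_mem (hdiag a) (S.sum_mem fun j _ => hswap a j)) ih

/-- A finite module over a principal ideal domain is a finite direct sum of cyclic modules,
expressed through the projections onto the summands. -/
theorem Module.exists_sum_eq_id_of_pid.{u, v} {R : Type u} {N : Type v} [CommRing R] [IsDomain R]
    [IsPrincipalIdealRing R] [AddCommGroup N] [Module R N] [Module.Finite R N] :
    ∃ (ι : Type u) (_ : Fintype ι) (p : ι → N →ₗ[R] N) (e : ι → N),
      ∑ i, p i = LinearMap.id ∧ ∀ i x, ∃ r : R, p i x = r • e i := by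
  classical
  obtain ⟨n, ι, _, q, _, k, ⟨φ⟩⟩ := Module.equiv_free_prod_directSum (R := R) (M := N)
  refine ⟨Fin n ⊕ ι, inferInstance,
    Sum.elim
      (fun i => φ.symm.toLinearMap ∘ₗ LinearMap.inl R _ _ ∘ₗ Finsupp.lsingle i ∘ₗ
        Finsupp.lapply i ∘ₗ LinearMap.fst R _ _ ∘ₗ φ.toLinearMap)
      (fun i => φ.symm.toLinearMap ∘ₗ LinearMap.inr R _ _ ∘ₗ DirectSum.lof R ι _ i ∘ₗ
        DirectSum.component R ι _ i ∘ₗ LinearMap.snd R _ _ ∘ₗ φ.toLinearMap),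
    Sum.elim
      (fun i => φ.symm (Finsupp.single i 1, 0))
      (fun i => φ.symm (0, DirectSum.lof R ι _ i (Submodule.Quotient.mk 1))), ?_, ?_⟩
  · ext x
    apply φ.injective
    have h₁ : ∑ i, Finsupp.single i ((φ x).1 i) = (φ x).1 := Finsupp.univ_sum_single _
    have h₂ : ∑ i, DirectSum.lof R ι _ i ((φ x).2 i) = (φ x).2 := DirectSum.sum_univ_of _
    simp only [Fintype.sum_sum_type, LinearMap.add_apply, LinearMap.sum_apply, map_add, map_sum]
    ext1
    · simp [Prod.fst_sum, h₁]
    · simpa [Prod.snd_sum, DirectSum.apply_eq_component R] using h₂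
  · rintro (i | i) x
    · refine ⟨(φ x).1 i, ?_⟩
      simp [← map_smul]
    · obtain ⟨r, hr⟩ := Submodule.Quotient.mk_surjective _ (DirectSum.component R ι _ i (φ x).2)
      refine ⟨r, ?_⟩
      simp only [Sum.elim_inr, LinearMap.comp_apply, LinearEquiv.coe_coe, LinearMap.snd_apply,
        LinearMap.inr_apply]
      rw [← hr, ← map_smul, Prod.smul_mk, smul_zero, ← map_smul, ← Submodule.Quotient.mk_smul,
        smul_eq_mul, mul_one]

namespace TensorProduct

/-- The submodule of `M ⊗ M` generated by the squares `x ⊗ x`. -/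
def squares (R M : Type*) [CommRing R] [AddCommGroup M] [Module R M] :
    Submodule R (M ⊗[R] M) :=
  Submodule.span R (Set.range fun x : M => x ⊗ₜ[R] x)

variable {R M N : Type*} [CommRing R] [AddCommGroup M] [Module R M] [AddCommGroup N] [Module R N]

theorem tmul_self_mem_squares (x : M) : x ⊗ₜ[R] x ∈ squares R M :=
  Submodule.subset_span ⟨x, rfl⟩

theorem add_comm_mem_squares (z : M ⊗[R] M) :
    z + TensorProduct.comm R M M z ∈ squares R M := by
  induction z with
  | zero => simp
  | tmul x y =>
    have h : x ⊗ₜ[R] y + y ⊗ₜ[R] x = (x + y) ⊗ₜ[R] (x + y) - x ⊗ₜ[R] x - y ⊗ₜ[R] y := by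
      simp only [add_tmul, tmul_add]
      abel
    rw [comm_tmul, h]
    exact sub_mem (sub_mem (tmul_self_mem_squares _) (tmul_self_mem_squares _))
      (tmul_self_mem_squares _)
  | add z w hz hw =>
    rw [map_add, add_add_add_comm]
    exact add_mem hz hw

theorem map_mem_squares (f : M →ₗ[R] N) {z : M ⊗[R] M} (hz : z ∈ squares R M) :
    map f f z ∈ squares R N := by
  have h : squares R M ≤ (squares R N).comap (map f f) := by
    refine Submodule.span_le.2 ?_
    rintro _ ⟨x, rfl⟩
    exact tmul_self_mem_squares (f x)
  exact h hz

theorem map_mem_squares_of_cyclic (p : M →ₗ[R] N) (e : N) (hp : ∀ x, ∃ r : R, p x = r • e)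
    (z : M ⊗[R] M) : map p p z ∈ squares R N := by
  induction z with
  | zero => simp
  | tmul x y =>
    obtain ⟨a, ha⟩ := hp x
    obtain ⟨b, hb⟩ := hp y
    rw [map_tmul, ha, hb, smul_tmul_smul]
    exact Submodule.smul_mem _ _ (tmul_self_mem_squares e)
  | add z w hz hw =>
    rw [map_add]
    exact add_mem hz hw

theorem mem_squares_of_comm_eq_of_finite [IsDomain R] [IsPrincipalIdealRing R]
    [Module.Finite R M] {z : M ⊗[R] M} (hz : TensorProduct.comm R M M z = z) :
    z ∈ squares R M := by
  obtain ⟨ι, _, p, e, hsum, hp⟩ := Module.exists_sum_eq_id_of_pid (R := R) (N := M)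
  have hz' : z = ∑ i, ∑ j, map (p i) (p j) z := by
    have h : ∑ i, ∑ j, map (p i) (p j) = LinearMap.id (R := R) (M := M ⊗[R] M) := by
      simp only [← mapBilinear_apply, ← map_sum, hsum]
      simp only [← LinearMap.sum_apply, ← map_sum, hsum]
      simp
    simpa [LinearMap.sum_apply] using (LinearMap.congr_fun h z).symm
  rw [hz']
  refine Submodule.sum_sum_mem_of_add_swap_mem _ _
    (fun i => map_mem_squares_of_cyclic (p i) (e i) (hp i) z) (fun i j => ?_) _
  have h : map (p j) (p i) z = TensorProduct.comm R M M (map (p i) (p j) z) := by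
    rw [← map_comm, hz]
  rw [h]
  exact add_comm_mem_squares _

theorem exists_fg_map_inclusion_eq_zero {P : Submodule R M} (hP : P.FG) {d : P ⊗[R] P}
    (hd : map P.subtype P.subtype d = 0) :
    ∃ (Q : Submodule R M) (h : P ≤ Q), Q.FG ∧
      map (Submodule.inclusion h) (Submodule.inclusion h) d = 0 := by
  rw [← LinearMap.rTensor_comp_lTensor, LinearMap.comp_apply] at hd
  obtain ⟨Q₁, h₁, hQ₁, hd₁⟩ := eq_zero_of_fg_of_subtype_eq_zero hP hd
  have hd₂ : LinearMap.rTensor Q₁ P.subtype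
      (TensorProduct.comm R Q₁ P (LinearMap.rTensor P (Submodule.inclusion h₁) d)) = 0 := by
    rw [← LinearMap.comp_apply, LinearMap.rTensor_comp_lTensor,
      ← LinearMap.lTensor_comp_rTensor, LinearMap.comp_apply] at hd₁
    rw [LinearMap.rTensor, map_comm, ← LinearMap.lTensor, hd₁, map_zero]
  obtain ⟨Q₂, h₂, hQ₂, hd₃⟩ := eq_zero_of_fg_of_subtype_eq_zero hP hd₂
  rw [LinearMap.rTensor, map_comm, ← LinearMap.lTensor, LinearEquiv.map_eq_zero_iff,
    ← LinearMap.comp_apply, LinearMap.lTensor_comp_rTensor] at hd₃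
  refine ⟨Q₁ ⊔ Q₂, h₁.trans le_sup_left, hQ₁.sup hQ₂, ?_⟩
  have h : map (Submodule.inclusion (h₁.trans (le_sup_left (b := Q₂))))
      (Submodule.inclusion (h₁.trans (le_sup_left (b := Q₂)))) =
      map (Submodule.inclusion (le_sup_left : Q₁ ≤ Q₁ ⊔ Q₂))
        (Submodule.inclusion (le_sup_right : Q₂ ≤ Q₁ ⊔ Q₂)) ∘ₗ
        map (Submodule.inclusion h₁) (Submodule.inclusion h₂) := by
    rw [← map_comp]
    rfl
  rw [h, LinearMap.comp_apply, hd₃, map_zero]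

theorem mem_squares_of_comm_eq [IsDomain R] [IsPrincipalIdealRing R] {z : M ⊗[R] M}
    (hz : TensorProduct.comm R M M z = z) : z ∈ squares R M := by
  obtain ⟨P₁, P₂, hP₁, hP₂, hs⟩ :=
    exists_finite_submodule_of_setFinite {z} (Set.finite_singleton z)
  obtain ⟨w₀, hw₀⟩ := hs rfl
  have hP : (P₁ ⊔ P₂).FG :=
    (Module.Finite.iff_fg.1 hP₁).sup (Module.Finite.iff_fg.1 hP₂)
  obtain ⟨w, hw⟩ : ∃ w, map (P₁ ⊔ P₂).subtype (P₁ ⊔ P₂).subtype w = z := by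
    refine ⟨map (Submodule.inclusion le_sup_left) (Submodule.inclusion le_sup_right) w₀, ?_⟩
    rw [← LinearMap.comp_apply, ← map_comp]
    exact hw₀
  obtain ⟨Q, hPQ, hQ, hd⟩ := exists_fg_map_inclusion_eq_zero hP
    (d := TensorProduct.comm R _ _ w - w) (by rw [map_sub, map_comm, hw, hz, sub_self])
  have : Module.Finite R Q := Module.Finite.iff_fg.2 hQ
  rw [map_sub, sub_eq_zero, map_comm] at hd
  have hmem := map_mem_squares Q.subtype (mem_squares_of_comm_eq_of_finite hd)
  rw [← LinearMap.comp_apply, ← map_comp] at hmem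
  rw [← hw]
  exact hmem

theorem comm_eq_of_mem_squares {z : M ⊗[R] M} (hz : z ∈ squares R M) :
    TensorProduct.comm R M M z = z := by
  have h : squares R M ≤
      LinearMap.eqLocus (TensorProduct.comm R M M).toLinearMap LinearMap.id := by
    refine Submodule.span_le.2 ?_
    rintro _ ⟨x, rfl⟩
    simp
  exact h hz

variable (R M) in
/-- The identification of `M ⊗ M` with the second tensor power of `M`. -/
noncomputable def equivPiFinTwo : M ⊗[R] M ≃ₗ[R] PiTensorProduct R (fun _ : Fin 2 => M) :=
  TensorProduct.congr (PiTensorProduct.subsingletonEquiv (s := fun _ => M) (0 : Fin 1)).symm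
      (PiTensorProduct.subsingletonEquiv (s := fun _ => M) (0 : Fin 1)).symm ≪≫ₗ
    PiTensorProduct.tmulEquiv R M ≪≫ₗ
    PiTensorProduct.reindex R (fun _ => M) (finSumFinEquiv (m := 1) (n := 1))

theorem equivPiFinTwo_tmul (x y : M) :
    equivPiFinTwo R M (x ⊗ₜ y) = PiTensorProduct.tprod R ![x, y] := by
  simp only [equivPiFinTwo, LinearEquiv.trans_apply, congr_tmul,
    PiTensorProduct.subsingletonEquiv_symm_apply', PiTensorProduct.tmulEquiv_apply,
    PiTensorProduct.reindex_tprod]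
  refine congrArg (PiTensorProduct.tprod R) (funext fun i => ?_)
  fin_cases i <;> rfl

theorem map_equivPiFinTwo_squares :
    (squares R M).map (equivPiFinTwo R M).toLinearMap = powersSubmodule R M 2 := by
  rw [squares, powersSubmodule, Submodule.map_span, ← Set.range_comp]
  congr 1
  ext z
  have h (x : M) : ![x, x] = fun _ => x := by
    ext i
    fin_cases i <;> rfl
  simp [equivPiFinTwo_tmul, h, eq_comm]

theorem permMap_swap_equivPiFinTwo (z : M ⊗[R] M) :
    permMap R M 2 (Equiv.swap 0 1) (equivPiFinTwo R M z) =
      equivPiFinTwo R M (TensorProduct.comm R M M z) := by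
  induction z with
  | zero => simp
  | tmul x y =>
    rw [comm_tmul, equivPiFinTwo_tmul, equivPiFinTwo_tmul, permMap, LinearEquiv.coe_coe,
      PiTensorProduct.reindex_tprod]
    congr 1
    ext i
    fin_cases i <;> rfl
  | add z w hz hw => simp only [map_add, hz, hw]

theorem equivPiFinTwo_mem_symTensors_iff (z : M ⊗[R] M) :
    equivPiFinTwo R M z ∈ symTensors R M 2 ↔ TensorProduct.comm R M M z = z := by
  simp only [symTensors, Submodule.mem_iInf, LinearMap.mem_eqLocus, LinearMap.id_apply]
  constructor
  · intro h
    exact (equivPiFinTwo R M).injective ((permMap_swap_equivPiFinTwo z).symm.trans (h _))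
  · intro h σ
    obtain rfl | rfl : σ = 1 ∨ σ = Equiv.swap 0 1 := by
      revert σ
      decide
    · exact LinearEquiv.congr_fun
        (PiTensorProduct.reindex_refl (R := R) (s := fun _ : Fin 2 => M)) _
    · rw [permMap_swap_equivPiFinTwo, h]

end TensorProduct

theorem powersSubmodule_two_eq_symTensors (R M : Type*) [CommRing R] [IsDomain R]
    [IsPrincipalIdealRing R] [AddCommGroup M] [Module R M] :
    powersSubmodule R M 2 = symTensors R M 2 := by
  ext t
  obtain ⟨z, rfl⟩ := (equivPiFinTwo R M).surjective t
  rw [equivPiFinTwo_mem_symTensors_iff, ← map_equivPiFinTwo_squares,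
    Submodule.mem_map_equiv, LinearEquiv.symm_apply_apply]
  exact ⟨comm_eq_of_mem_squares, mem_squares_of_comm_eq⟩

/-- For any `ℤ`-module `M`, `P₂(M) = S'₂(M)`: the submodule of `T²(M)` generated
by the squares `x ⊗ x` equals the submodule of symmetric tensors. -/
theorem stmt_16 (M : Type*) [AddCommGroup M] [Module ℤ M] :
    powersSubmodule ℤ M 2 = symTensors ℤ M 2 := by
  exact powersSubmodule_two_eq_symTensors ℤ M
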